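/- Fix an odd integer m ≥ 7 and a point x ∈ C_m all of whose coordinates are positive. If e(x) = m − 3, then 2 ≤ d(x) ≤ m − 3. -/

import Mathlib

open scoped BigOperators

/-- The Kunz cone `C_m`: points indexed by residues modulo `m` (the coordinate at `0` is
ignored) satisfying `x i + x j ≥ x (i+j)` for nonzero `i, j` with `i + j ≠ 0`. -/
def KunzCone (m : ℕ) : Set (ZMod m → ℝ) :=
  {x | ∀ i j : ZMod m, i ≠ 0 → j ≠ 0 → i + j ≠ 0 → x (i + j) ≤ x i + x j}

/-- The equality set `E(x)` of a point of the Kunz cone. -/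
def EqualitySet (m : ℕ) (x : ZMod m → ℝ) : Set (ZMod m × ZMod m) :=
  {p | p.1 ≠ 0 ∧ p.2 ≠ 0 ∧ p.1 + p.2 ≠ 0 ∧ x p.1 + x p.2 = x (p.1 + p.2)}

/-- An Apéry point of `C_m`: a point of the cone with integer coordinates with
`y i ≡ i (mod m)` for every nonzero `i`. -/
def IsAperyPoint (m : ℕ) (y : ZMod m → ℝ) : Prop :=
  y ∈ KunzCone m ∧ ∀ i : ZMod m, i ≠ 0 → ∃ z : ℤ, y i = (z : ℝ) ∧ (z : ZMod m) = i

/-- The atoms `A(x)` of a point of the Kunz cone with positive coordinates. -/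
def KunzAtoms (m : ℕ) (x : ZMod m → ℝ) : Set (ZMod m) :=
  {a | a ≠ 0 ∧ ∀ i j : ZMod m, i ≠ 0 → j ≠ 0 → i + j = a → x i + x j ≠ x a}

/-- `e(x)`, the number of atoms. -/
noncomputable def kunzE (m : ℕ) (x : ZMod m → ℝ) : ℕ := (KunzAtoms m x).ncard

/-- The normal vector `e_i + e_j - e_{i+j}` of a supporting hyperplane of the Kunz cone. -/
def hypVec (m : ℕ) (i j : ZMod m) : ZMod m → ℚ :=
  Pi.single i 1 + Pi.single j 1 - Pi.single (i + j) 1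

/-- `d(x)`, the dimension of the face of `C_m` whose relative interior contains `x`. -/
noncomputable def kunzD (m : ℕ) (x : ZMod m → ℝ) : ℕ :=
  (m - 1) - Module.finrank ℚ (Submodule.span ℚ
    {v : ZMod m → ℚ | ∃ p ∈ EqualitySet m x, v = hypVec m p.1 p.2})

/-- `z : ℕ^{A(x)}` is a factorization of the nonzero residue `a`. -/
def IsKunzFactorization (m : ℕ) [NeZero m] (x : ZMod m → ℝ) (a : ZMod m)
    (z : ZMod m → ℕ) : Prop :=
  (∀ c, z c ≠ 0 → c ∈ KunzAtoms m x) ∧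
  (∑ c : ZMod m, (z c : ZMod m) * c) = a ∧
  (∑ c : ZMod m, (z c : ℝ) * x c) = x a

/-- `Z(a)`, the set of factorizations of `a`. -/
def KunzFactorizations (m : ℕ) [NeZero m] (x : ZMod m → ℝ) (a : ZMod m) :
    Set (ZMod m → ℕ) :=
  {z | IsKunzFactorization m x a z}

/-- The presentation lattice `L(x)`: the subgroup of `ℤ^{A(x)}` generated by all differences
of pairs of factorizations of a common nonzero residue. -/
def PresentationLattice (m : ℕ) [NeZero m] (x : ZMod m → ℝ) :
    AddSubgroup (ZMod m → ℤ) :=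
  AddSubgroup.closure {v | ∃ a : ZMod m, a ≠ 0 ∧ ∃ z z',
    z ∈ KunzFactorizations m x a ∧ z' ∈ KunzFactorizations m x a ∧
    v = fun c => (z c : ℤ) - (z' c : ℤ)}

section KunzRank

variable {m : ℕ} {x : ZMod m → ℝ}

lemma swap_mem_equalitySet {i j : ZMod m} (h : (i, j) ∈ EqualitySet m x) :
    (j, i) ∈ EqualitySet m x := by
  obtain ⟨h1, h2, h3, h4⟩ := h
  refine ⟨h2, h1, ?_, ?_⟩
  · simpa [add_comm] using h3
  · simpa [add_comm] using h4

lemma hypVec_comm (i j : ZMod m) : hypVec m i j = hypVec m j i := by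
  simp only [hypVec, add_comm]

/-- For odd `m`, every residue has a representative `h ± k` with `k ≤ (m - 1) / 2`. -/
lemma exists_half_representative [NeZero m] (hodd : Odd m) (h i : ZMod m) :
    ∃ k < (m + 1) / 2, i = h + (k : ZMod m) ∨ i = h - (k : ZMod m) := by
  obtain ⟨c, hc⟩ := hodd
  have hlt := ZMod.val_lt (i - h)
  have hval := ZMod.natCast_zmod_val (i - h)
  by_cases hk : (i - h).val ≤ c
  · refine ⟨(i - h).val, by omega, Or.inl ?_⟩
    rw [hval]; ring
  · refine ⟨m - (i - h).val, by omega, Or.inr ?_⟩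
    rw [Nat.cast_sub hlt.le, hval, ZMod.natCast_self]; ring

lemma exists_add_self_eq (hodd : Odd m) (r : ZMod m) : ∃ h : ZMod m, h + h = r := by
  obtain ⟨c, hc⟩ := hodd
  refine ⟨(c + 1 : ℕ) * r, ?_⟩
  have hm : ((2 * c + 1 : ℕ) : ZMod m) = 0 := by rw [← hc, ZMod.natCast_self]
  push_cast at hm ⊢
  linear_combination r * hm

/-- The normal vectors of the equalities with sum `r` are at most `(m + 1) / 2` in number, and
each pair `{i, r - i}` which is not an equality lowers this bound by one. -/
lemma exists_finset_hypVec [NeZero m] (hodd : Odd m) (r : ZMod m) (X : Finset (ZMod m))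
    (hX : ∀ i ∈ X, ∀ j ∈ X, i = j ∨ i + j ≠ r)
    (hE : ∀ i ∈ X, (i, r - i) ∉ EqualitySet m x) :
    ∃ T : Finset (ZMod m → ℚ), T.card + X.card ≤ (m + 1) / 2 ∧
      ∀ i j, (i, j) ∈ EqualitySet m x → i + j = r → hypVec m i j ∈ T := by
  classical
  obtain ⟨h, rfl⟩ := exists_add_self_eq hodd r
  choose κ hκ hrep using exists_half_representative hodd h
  have hpair : ∀ i j, κ i = κ j → i = j ∨ i + j = h + h := by
    intro i j hij
    have hi := hrep i
    have hj := hrep j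
    rw [hij] at hi
    rcases hi with hi | hi <;> rcases hj with hj | hj
    · exact Or.inl (hi.trans hj.symm)
    · right; linear_combination hi + hj
    · right; linear_combination hi + hj
    · exact Or.inl (hi.trans hj.symm)
  have hinj : Set.InjOn κ X := fun i hi j hj hij =>
    (hpair i j hij).elim id fun hsum => (hX i hi j hj).resolve_right fun hne => hne hsum
  refine ⟨(Finset.range ((m + 1) / 2) \ X.image κ).image
    fun k : ℕ => hypVec m (h + (k : ZMod m)) (h - (k : ZMod m)), ?_, ?_⟩
  · have hsub : X.image κ ⊆ Finset.range ((m + 1) / 2) := by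
      intro k hk
      obtain ⟨i, -, rfl⟩ := Finset.mem_image.1 hk
      exact Finset.mem_range.2 (hκ i)
    have h1 := Finset.card_sdiff_add_card_eq_card hsub
    rw [Finset.card_image_of_injOn hinj, Finset.card_range] at h1
    exact (Nat.add_le_add_right Finset.card_image_le _).trans h1.le
  · intro i j hij hsum
    refine Finset.mem_image.2 ⟨κ i, Finset.mem_sdiff.2 ⟨Finset.mem_range.2 (hκ i), ?_⟩, ?_⟩
    · intro hmem
      obtain ⟨u, hu, huk⟩ := Finset.mem_image.1 hmem
      have hj : j = h + h - i := by linear_combination hsum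
      rcases hpair u i huk with rfl | hui
      · exact hE u hu (hj ▸ hij)
      · have h1 : u = j := by linear_combination hui - hsum
        have h2 : h + h - u = i := by linear_combination -hui
        exact hE u hu (by rw [h2, h1]; exact swap_mem_equalitySet hij)
    · rcases hrep i with hi | hi
      · have hj : j = h - (κ i : ZMod m) := by linear_combination hsum - hi
        rw [← hi, ← hj]
      · have hj : j = h + (κ i : ZMod m) := by linear_combination hsum - hi
        rw [← hi, ← hj, hypVec_comm]

/-- If the two sums `p` and `q` exhaust the equalities, the rank is bounded by the number of
pairs with sum `p` or `q` minus the number of excluded pairs. -/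
lemma finrank_add_card_le [NeZero m] (hodd : Odd m) {p q : ZMod m}
    (hpq : ∀ i j, (i, j) ∈ EqualitySet m x → i + j = p ∨ i + j = q) (X Y : Finset (ZMod m))
    (hX : ∀ i ∈ X, ∀ j ∈ X, i = j ∨ i + j ≠ p) (hXE : ∀ i ∈ X, (i, p - i) ∉ EqualitySet m x)
    (hY : ∀ i ∈ Y, ∀ j ∈ Y, i = j ∨ i + j ≠ q) (hYE : ∀ i ∈ Y, (i, q - i) ∉ EqualitySet m x) :
    Module.finrank ℚ (Submodule.span ℚ
      {v : ZMod m → ℚ | ∃ p ∈ EqualitySet m x, v = hypVec m p.1 p.2}) + X.card + Y.card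
      ≤ m + 1 := by
  classical
  obtain ⟨S, hS, hS'⟩ := exists_finset_hypVec hodd p X hX hXE
  obtain ⟨T, hT, hT'⟩ := exists_finset_hypVec hodd q Y hY hYE
  have hsub : {v : ZMod m → ℚ | ∃ p ∈ EqualitySet m x, v = hypVec m p.1 p.2} ⊆
      ((S ∪ T : Finset (ZMod m → ℚ)) : Set (ZMod m → ℚ)) := by
    rintro v ⟨⟨i, j⟩, hij, rfl⟩
    rcases hpq i j hij with h | h
    · exact Finset.mem_coe.2 (Finset.mem_union_left _ (hS' i j hij h))
    · exact Finset.mem_coe.2 (Finset.mem_union_right _ (hT' i j hij h))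
  have h1 := Submodule.finrank_mono (Submodule.span_mono (R := ℚ) hsub)
  have h2 := finrank_span_finset_le_card (R := ℚ) (S ∪ T)
  have h3 := Finset.card_union_le S T
  rw [Set.finrank] at h2
  omega

lemma mem_equalitySet_of_sum_eq {i j a : ZMod m} (hi : i ≠ 0) (hj : j ≠ 0) (ha : a ≠ 0)
    (hsum : i + j = a) (hx : x i + x j = x a) : (i, j) ∈ EqualitySet m x := by
  subst hsum
  exact ⟨hi, hj, ha, hx⟩

lemma two_le_finrank [NeZero m] (hpos : ∀ i : ZMod m, i ≠ 0 → 0 < x i) {p q : ZMod m}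
    (hne : p ≠ q) (hle : x p ≤ x q) {i j k l : ZMod m} (hij : (i, j) ∈ EqualitySet m x)
    (hijp : i + j = p) (hkl : (k, l) ∈ EqualitySet m x) (hklq : k + l = q) :
    2 ≤ Module.finrank ℚ (Submodule.span ℚ
      {v : ZMod m → ℚ | ∃ p ∈ EqualitySet m x, v = hypVec m p.1 p.2}) := by
  have hli : LinearIndependent ℚ ![hypVec m i j, hypVec m k l] := by
    obtain ⟨hi, hj, -, hxij⟩ := hij
    obtain ⟨hk, hl, -, hxkl⟩ := hkl
    dsimp only at hi hj hk hl hxij hxkl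
    rw [hijp] at hxij
    rw [hklq] at hxkl
    have hi' := hpos i hi
    have hj' := hpos j hj
    have hk' := hpos k hk
    have hl' := hpos l hl
    have hpi : p ≠ i := by rintro rfl; linarith
    have hpj : p ≠ j := by rintro rfl; linarith
    have hqi : q ≠ i := by rintro rfl; linarith
    have hqj : q ≠ j := by rintro rfl; linarith
    have hqk : q ≠ k := by rintro rfl; linarith
    have hql : q ≠ l := by rintro rfl; linarith
    rw [LinearIndependent.pair_iff]
    intro a b hab
    have hq := congrFun hab q
    have hp := congrFun hab p
    simp only [hypVec, hijp, hklq, Pi.add_apply, Pi.smul_apply, Pi.sub_apply, Pi.zero_apply,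
      Pi.single_eq_same, Pi.single_eq_of_ne hpi, Pi.single_eq_of_ne hpj, Pi.single_eq_of_ne hqi,
      Pi.single_eq_of_ne hqj, Pi.single_eq_of_ne hqk, Pi.single_eq_of_ne hql,
      Pi.single_eq_of_ne hne, Pi.single_eq_of_ne hne.symm, smul_eq_mul] at hq hp
    have hb : b = 0 := by linarith
    subst hb
    exact ⟨by linarith, rfl⟩
  have h1 := finrank_span_eq_card hli
  have hsub : Set.range ![hypVec m i j, hypVec m k l] ⊆
      {v : ZMod m → ℚ | ∃ p ∈ EqualitySet m x, v = hypVec m p.1 p.2} := by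
    rintro _ ⟨n, rfl⟩
    fin_cases n
    · exact ⟨(i, j), hij, rfl⟩
    · exact ⟨(k, l), hkl, rfl⟩
  have h2 := Submodule.finrank_mono (Submodule.span_mono (R := ℚ) hsub)
  rw [h1, Fintype.card_fin] at h2
  exact h2

/-- The rank is at most `m - 3` when the equalities have only two sums. -/
lemma finrank_add_three_le [NeZero m] (hm : 7 ≤ m) (hodd : Odd m)
    (hpos : ∀ i : ZMod m, i ≠ 0 → 0 < x i) {p q : ZMod m} (hp : p ≠ 0) (hq : q ≠ 0)
    (hne : p ≠ q) (hle : x p ≤ x q)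
    (hpq : ∀ i j, (i, j) ∈ EqualitySet m x → i + j = p ∨ i + j = q) :
    Module.finrank ℚ (Submodule.span ℚ
      {v : ZMod m → ℚ | ∃ p ∈ EqualitySet m x, v = hypVec m p.1 p.2}) + 3 ≤ m := by
  classical
  by_contra hcon
  have h0 : ∀ r : ZMod m, ((0 : ZMod m), r - 0) ∉ EqualitySet m x := fun r h => h.1 rfl
  have hqp : (q, p - q) ∉ EqualitySet m x := by
    rintro ⟨-, h2, -, h4⟩
    have := hpos _ h2
    simp only [add_sub_cancel] at h4
    linarith
  have hEp : ∀ u, u ≠ 0 → u ≠ p → u ≠ q → u ≠ p - q → (u, p - u) ∈ EqualitySet m x := by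
    intro u hu0 hup huq hupq
    by_contra hu
    have huq' : u + q ≠ p := fun h => hupq (by linear_combination h)
    have hquq : q + u ≠ p := by rwa [add_comm]
    have hcard : ({0, q, u} : Finset (ZMod m)).card = 3 :=
      Finset.card_eq_three.2 ⟨0, q, u, hq.symm, hu0.symm, huq.symm, rfl⟩
    have := finrank_add_card_le hodd hpq {0, q, u} {0}
      (by simp [hne.symm, hup, huq', hquq]) (by simpa using ⟨by simpa using h0 p, hqp, hu⟩)
      (by simp) (by simpa using h0 q)
    rw [hcard, Finset.card_singleton] at this
    omega
  have hEq : ∀ u, u ≠ 0 → u ≠ q → (u, q - u) ∈ EqualitySet m x := by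
    intro u hu0 huq
    by_contra hu
    have := finrank_add_card_le hodd hpq {0, q} {0, u}
      (by simp [hne.symm]) (by simpa using ⟨by simpa using h0 p, hqp⟩)
      (by simp [huq]) (by simpa using ⟨by simpa using h0 q, hu⟩)
    rw [Finset.card_pair hq.symm, Finset.card_pair hu0.symm] at this
    omega
  have hpt := (hEq p hp hne).2.2.2
  simp only [add_sub_cancel] at hpt
  have hsub : (Finset.univ : Finset (ZMod m)) ⊆ {0, p, q, p - q, p - (q - p)} := by
    intro k _
    simp only [Finset.mem_insert, Finset.mem_singleton]
    by_contra! hk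
    obtain ⟨hk0, hkp, hkq, hkt, hk'⟩ := hk
    have h1 := (hEp k hk0 hkp hkq hkt).2.2.2
    have h2 := (hEq (p - k) (sub_ne_zero.2 hkp.symm)
      (fun h => hkt (by linear_combination -h))).2.2.2
    simp only [add_sub_cancel] at h1 h2
    have h3 : q - (p - k) = k + (q - p) := by ring
    rw [h3] at h2
    have hE : (k, q - p) ∈ EqualitySet m x :=
      ⟨hk0, sub_ne_zero.2 hne.symm, fun h => hkt (by dsimp only at h; linear_combination h),
        by dsimp only; linarith⟩
    rcases hpq _ _ hE with h | h
    · exact hk' (by linear_combination h)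
    · exact hkp (by linear_combination h)
  have hcard := Finset.card_le_card hsub
  rw [Finset.card_univ, ZMod.card] at hcard
  have := hcard.trans Finset.card_le_five
  omega

lemma exists_mem_equalitySet {a : ZMod m} (ha : a ≠ 0) (hatom : a ∉ KunzAtoms m x) :
    ∃ i j, (i, j) ∈ EqualitySet m x ∧ i + j = a := by
  simp only [KunzAtoms, Set.mem_ofPred_eq] at hatom
  push Not at hatom
  obtain ⟨i, j, hi, hj, hij, h⟩ := hatom ha
  exact ⟨i, j, mem_equalitySet_of_sum_eq hi hj ha hij h, hij⟩

lemma add_notMem_kunzAtoms {i j : ZMod m} (h : (i, j) ∈ EqualitySet m x) :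
    i + j ∉ KunzAtoms m x := fun ha => ha.2 i j h.1 h.2.1 rfl h.2.2.2

/-- When `e(x) = m - 3`, exactly two nonzero residues are not atoms. -/
lemma exists_nonatoms [NeZero m] (hm : 3 ≤ m) (he : kunzE m x = m - 3) :
    ∃ p q : ZMod m, p ≠ q ∧ (insert 0 (KunzAtoms m x))ᶜ = {p, q} := by
  rw [← Set.ncard_eq_two]
  have h0 : (0 : ZMod m) ∉ KunzAtoms m x := fun h => h.1 rfl
  have h1 := Set.ncard_insert_of_notMem h0
  have h2 := Set.ncard_add_ncard_compl (insert 0 (KunzAtoms m x))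
  rw [Nat.card_zmod] at h2
  rw [kunzE] at he
  omega

end KunzRank

/-- For odd `m ≥ 7`: if `e(x) = m - 3` then `2 ≤ d(x) ≤ m - 3`. -/
theorem dim_bounds_of_embdim_eq_m_sub_three (m : ℕ) (hm : 7 ≤ m) (hodd : Odd m) [NeZero m]
    (x : ZMod m → ℝ) (hx : x ∈ KunzCone m) (hpos : ∀ i : ZMod m, i ≠ 0 → 0 < x i)
    (he : kunzE m x = m - 3) :
    2 ≤ kunzD m x ∧ kunzD m x ≤ m - 3 := by
  obtain ⟨p, q, hne, hpq⟩ := exists_nonatoms (by omega) he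
  wlog hle : x p ≤ x q generalizing p q
  · exact this q p hne.symm (hpq.trans (Set.pair_comm p q)) (le_of_not_ge hle)
  have hmem : ∀ a : ZMod m, (a ≠ 0 ∧ a ∉ KunzAtoms m x) ↔ a = p ∨ a = q := by
    intro a
    have := Set.ext_iff.1 hpq a
    simpa using this
  obtain ⟨hp, hpA⟩ := (hmem p).2 (Or.inl rfl)
  obtain ⟨hq, hqA⟩ := (hmem q).2 (Or.inr rfl)
  obtain ⟨i, j, hij, hijp⟩ := exists_mem_equalitySet hp hpA
  obtain ⟨k, l, hkl, hklq⟩ := exists_mem_equalitySet hq hqA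
  have hlow := two_le_finrank hpos hne hle hij hijp hkl hklq
  have hup := finrank_add_three_le hm hodd hpos hp hq hne hle
    fun i j h => (hmem _).1 ⟨h.2.2.1, add_notMem_kunzAtoms h⟩
  rw [kunzD]
  omega
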